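/- Strict one-step improvement when the two models are distinguishable: Let K = 2, let u_k, v_k be real numbers for k = 1,2 with (u_1, v_1) ≠ (u_2, v_2), and let q = (q_1, q_2) be a probability vector with q_1 > 0 and q_2 > 0. Then the expected posterior probability of model 1 when the outcome is drawn from model 1 strictly exceeds its prior probability: Σ_{y ∈ {−1,1}²} σ̃_1(y) · q'_1(y) > q_1. -/

import Mathlib

/-- The logistic function `σ(h) = 1/(1 + exp(-h))`. -/
noncomputable def sig (h : ℝ) : ℝ := 1 / (1 + Real.exp (-h))

/-- Encoding of an element of `{-1, 1}` by a Boolean: `true ↦ 1`, `false ↦ -1`. -/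
def pm (b : Bool) : ℝ := if b then 1 else -1

/-- The likelihood `σ̃(y) = σ(y^c · u) · σ(y^s · v)` of the pair outcome
`y = (y^c, y^s) ∈ {-1,1}²` under the model with parameters `(u, v)`. -/
noncomputable def lik (u v : ℝ) (y : Bool × Bool) : ℝ :=
  sig (pm y.1 * u) * sig (pm y.2 * v)

lemma sig_pos (h : ℝ) : 0 < sig h := by
  unfold sig
  positivity

lemma sig_add_sig_neg (h : ℝ) : sig h + sig (-h) = 1 := by
  have hexp : Real.exp h * Real.exp (-h) = 1 := by
    rw [← Real.exp_add, add_neg_cancel, Real.exp_zero]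
  unfold sig
  rw [neg_neg, div_add_div _ _ (by positivity) (by positivity), div_eq_one_iff_eq (by positivity)]
  linear_combination -hexp

lemma sig_injective : Function.Injective sig := by
  intro a b hab
  simpa [sig] using hab

lemma lik_pos (u v : ℝ) (y : Bool × Bool) : 0 < lik u v y :=
  mul_pos (sig_pos _) (sig_pos _)

lemma lik_marginal_fst (u v : ℝ) : lik u v (true, true) + lik u v (true, false) = sig u := by
  simp only [lik, pm, if_true, Bool.false_eq_true, if_false, one_mul, neg_one_mul]
  linear_combination sig u * sig_add_sig_neg v

lemma lik_marginal_snd (u v : ℝ) : lik u v (true, true) + lik u v (false, true) = sig v := by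
  simp only [lik, pm, if_true, Bool.false_eq_true, if_false, one_mul, neg_one_mul]
  linear_combination sig v * sig_add_sig_neg u

lemma sum_lik (u v : ℝ) : ∑ y, lik u v y = 1 := by
  simp only [Fintype.sum_prod_type, Fintype.sum_bool, lik, pm, if_true, Bool.false_eq_true,
    if_false, one_mul, neg_one_mul]
  linear_combination (sig u + sig (-u)) * sig_add_sig_neg v + sig_add_sig_neg u

/-- The likelihood function determines the parameters of the model. -/
lemma exists_lik_ne {u v a b : ℝ} (h : (u, v) ≠ (a, b)) : ∃ y, lik u v y ≠ lik a b y := by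
  contrapose! h
  refine Prod.ext (sig_injective ?_) (sig_injective ?_)
  · rw [← lik_marginal_fst u v, ← lik_marginal_fst a b, h, h]
  · rw [← lik_marginal_snd u v, ← lik_marginal_snd a b, h, h]

/-- Tangent-line bound for `p ↦ p ^ 2 / m` at `p = m`. -/
lemma two_mul_sub_le_sq_div {m : ℝ} (p : ℝ) (hm : 0 < m) : 2 * p - m ≤ p ^ 2 / m := by
  rw [le_div_iff₀ hm]
  nlinarith [sq_nonneg (p - m)]

lemma two_mul_sub_lt_sq_div {p m : ℝ} (hm : 0 < m) (hpm : p ≠ m) : 2 * p - m < p ^ 2 / m := by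
  rw [lt_div_iff₀ hm]
  nlinarith [sq_pos_of_ne_zero (sub_ne_zero.mpr hpm)]

/-- Strict positivity of the `χ²`-divergence between distinct distributions. -/
lemma one_lt_sum_sq_div {ι : Type*} [Fintype ι] {p m : ι → ℝ} (hm : ∀ i, 0 < m i)
    (hp_sum : ∑ i, p i = 1) (hm_sum : ∑ i, m i = 1) (hpm : ∃ i, p i ≠ m i) :
    1 < ∑ i, p i ^ 2 / m i := by
  obtain ⟨i, hi⟩ := hpm
  calc (1 : ℝ) = ∑ i, (2 * p i - m i) := by
        rw [Finset.sum_sub_distrib, ← Finset.mul_sum, hp_sum, hm_sum]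
        norm_num
    _ < ∑ i, p i ^ 2 / m i :=
        Finset.sum_lt_sum (fun j _ => two_mul_sub_le_sq_div (p j) (hm j))
          ⟨i, Finset.mem_univ i, two_mul_sub_lt_sq_div (hm i) hi⟩

/-- Strict one-step improvement when the two models are distinguishable: if
`(u 1, v 1) ≠ (u 2, v 2)` and both prior probabilities are positive, then the expected
posterior probability of model `1` (index `0`), under outcomes drawn from model `1`,
strictly exceeds its prior probability. -/
theorem expected_posterior_gt_prior_of_distinguishable
    (u v : Fin 2 → ℝ) (q : Fin 2 → ℝ)
    (hq : ∀ k, 0 ≤ q k) (hsum : ∑ k, q k = 1)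
    (hne : (u 0, v 0) ≠ (u 1, v 1)) (hq0 : 0 < q 0) (hq1 : 0 < q 1) :
    q 0 < ∑ y : Bool × Bool, lik (u 0) (v 0) y *
      (q 0 * lik (u 0) (v 0) y / ∑ j, q j * lik (u j) (v j) y) := by
  rw [Fin.sum_univ_two] at hsum
  simp only [Fin.sum_univ_two]
  set p := lik (u 0) (v 0)
  set r := lik (u 1) (v 1)
  have hm : ∀ y, 0 < q 0 * p y + q 1 * r y := fun y =>
    add_pos (mul_pos hq0 (lik_pos _ _ y)) (mul_pos hq1 (lik_pos _ _ y))
  have hm_sum : ∑ y, (q 0 * p y + q 1 * r y) = 1 := by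
    rw [Finset.sum_add_distrib, ← Finset.mul_sum, ← Finset.mul_sum, sum_lik, sum_lik]
    linarith
  have hpm : ∃ y, p y ≠ q 0 * p y + q 1 * r y := by
    obtain ⟨y, hy⟩ := exists_lik_ne hne
    refine ⟨y, fun h => hy (mul_left_cancel₀ (ne_of_gt hq1) ?_)⟩
    linear_combination h + p y * hsum
  calc q 0 = q 0 * 1 := (mul_one _).symm
    _ < q 0 * ∑ y, p y ^ 2 / (q 0 * p y + q 1 * r y) :=
        mul_lt_mul_of_pos_left (one_lt_sum_sq_div hm (sum_lik _ _) hm_sum hpm) hq0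
    _ = ∑ y, p y * (q 0 * p y / (q 0 * p y + q 1 * r y)) := by
        rw [Finset.mul_sum]
        exact Finset.sum_congr rfl fun y _ => by ring
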